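/- Let P be a prime power, q = P^e, W ⊆ F_q an F_P-vector subspace, Q_W(x) = ∏_{w ∈ W}(x - w), and Y = { Q_W(a) : a ∈ F_q }. Let τ ∈ F_q and let v ∈ F̄_q satisfy Q_W(v) = τ. Then v^q - v = Q_Y(τ), where Q_Y(x) = ∏_{y ∈ Y}(x - y); in particular Q_Y(τ) ∈ W. -/

import Mathlib

open Polynomial

/-- For a finite subset `S` of a finite field, the polynomial `∏_{s ∈ S} (x - s)`. -/
noncomputable def vanishingPoly {K : Type*} [Field K] [Finite K] (S : Set K) : K[X] :=
  ∏ y ∈ (Set.toFinite S).toFinset, (X - C y)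

theorem X_pow_card_sub_X_eq_prod_X_sub_C (K : Type*) [Field K] [Fintype K] :
    (X ^ Fintype.card K - X : K[X]) = ∏ a : K, (X - C a) := by
  have hlt : 1 < Fintype.card K := Fintype.one_lt_card
  have hmon : (X ^ Fintype.card K - X : K[X]).Monic :=
    monic_X_pow_sub (by rw [degree_X]; exact_mod_cast hlt)
  have hroots := FiniteField.roots_X_pow_card_sub_X K
  have h := prod_multiset_X_sub_C_of_monic_of_roots_card_eq hmon (by
    rw [hroots, FiniteField.X_pow_card_sub_X_natDegree_eq K hlt]
    rfl)
  rw [← h, hroots]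
  rfl

theorem prod_sub_sub_prod_sub_of_injective {G L : Type*} [AddCommGroup G] [Fintype G] [Field L]
    (f : G →+ L) (hf : Function.Injective f) (x y : L) :
    (∏ g, (x - f g)) - ∏ g, (y - f g) = ∏ g, (x - y - f g) := by
  classical
  have hdeg (z : L) : (∏ g, (X - C (z + f g))).degree = (Fintype.card G : WithBot ℕ) := by
    simp only [degree_prod, degree_X_sub_C]
    simp
  have hmon (z : L) : (∏ g, (X - C (z + f g))).Monic :=
    monic_prod_of_monic _ _ fun _ _ => monic_X_sub_C _
  have hpos : (0 : WithBot ℕ) < Fintype.card G := by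
    exact_mod_cast Fintype.card_pos
  have hC (c : L) : (C c).degree < (∏ g, (X - C (0 + f g))).degree := by
    rw [hdeg]
    exact degree_C_le.trans_lt hpos
  have key : (∏ g, (X - C (0 + f g))) - C (∏ g, (y - f g)) = ∏ g, (X - C (y + f g)) := by
    refine eq_of_degree_le_of_eval_finset_eq (Finset.univ.image fun g => y + f g) ?_ ?_ ?_ ?_
    · rw [degree_sub_eq_left_of_degree_lt (hC _), hdeg, Finset.card_image_of_injective]
      · simp
      · exact fun a b h => hf (add_left_cancel h)
    · rw [degree_sub_eq_left_of_degree_lt (hC _), hdeg, hdeg]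
    · rw [leadingCoeff_sub_of_degree_lt (hC _), (hmon 0).leadingCoeff, (hmon y).leadingCoeff]
    · simp only [Finset.mem_image, Finset.mem_univ, true_and, forall_exists_index,
        forall_apply_eq_imp_iff]
      intro h
      have hzero : ∏ g, (y + f h - (y + f g)) = 0 :=
        Finset.prod_eq_zero (Finset.mem_univ h) (sub_self _)
      have hshift : ∏ g, (y + f h - f g) = ∏ g, (y - f g) :=
        Fintype.prod_equiv (Equiv.subRight h) _ _ fun g => by simp; ring
      simp only [eval_sub, eval_prod, eval_X, eval_C, zero_add, hzero, hshift, sub_self]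
  have := congrArg (eval x) key
  simpa [eval_prod, sub_sub] using this

theorem aeval_vanishingPoly {K L : Type*} [Field K] [Finite K] [Field L] [Algebra K L]
    (S : Set K) (x : L) :
    aeval x (vanishingPoly S) = ∏ y ∈ (Set.toFinite S).toFinset, (x - algebraMap K L y) := by
  simp [vanishingPoly, map_prod]

section Subspace

variable {F K L : Type*} [Field F] [Field K] [Finite K] [Field L] [Algebra F K] [Algebra K L]

theorem aeval_vanishingPoly_sub (W : Submodule F K) (x y : L) :
    aeval x (vanishingPoly (W : Set K)) - aeval y (vanishingPoly (W : Set K)) =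
      aeval (x - y) (vanishingPoly (W : Set K)) := by
  have := Fintype.ofFinite W
  have hprod (z : L) : aeval z (vanishingPoly (W : Set K)) =
      ∏ w : W, (z - ((algebraMap K L : K →+ L).comp W.subtype.toAddMonoidHom) w) := by
    rw [aeval_vanishingPoly]
    exact Finset.prod_subtype _ (by simp) _
  rw [hprod, hprod, hprod]
  exact prod_sub_sub_prod_sub_of_injective _
    ((algebraMap K L).injective.comp W.subtype_injective) x y

theorem aeval_vanishingPoly_algebraMap_eq_zero_iff (S : Set K) (a : K) :
    aeval (algebraMap K L a) (vanishingPoly S) = 0 ↔ a ∈ S := by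
  simp [aeval_vanishingPoly, Finset.prod_eq_zero_iff, sub_eq_zero]

theorem aeval_vanishingPoly_range (W : Submodule F K) (x : L) :
    aeval (aeval x (vanishingPoly (W : Set K)))
        (vanishingPoly (Set.range fun y : K => (vanishingPoly (W : Set K)).eval y)) =
      x ^ Nat.card K - x := by
  classical
  have := Fintype.ofFinite K
  set Q := vanishingPoly (W : Set K) with hQ
  have hall : x ^ Nat.card K - x = ∏ a : K, (x - algebraMap K L a) := by
    have := congrArg (aeval x) (X_pow_card_sub_X_eq_prod_X_sub_C K)
    simpa [map_prod] using this
  rw [hall, aeval_vanishingPoly, ← Finset.prod_fiberwise_of_maps_to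
    (s := Finset.univ) (t := (Set.toFinite (Set.range fun y : K => Q.eval y)).toFinset)
    (g := fun y => Q.eval y) (by simp)]
  refine Finset.prod_congr rfl fun y hy => ?_
  obtain ⟨b, rfl⟩ : ∃ b, Q.eval b = y := by simpa using hy
  have hb : algebraMap K L (Q.eval b) = aeval (algebraMap K L b) Q := by
    rw [aeval_algebraMap_apply, coe_aeval_eq_eval]
  rw [hb, hQ, aeval_vanishingPoly_sub, aeval_vanishingPoly]
  refine Finset.prod_bij' (fun w _ => w + b) (fun a _ => a - b) ?_ ?_ ?_ ?_ ?_
  · intro w hw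
    have h := aeval_vanishingPoly_sub (L := K) W (w + b) b
    have h0 := (aeval_vanishingPoly_algebraMap_eq_zero_iff (L := K) (W : Set K) w).2
      (by simpa using hw)
    simp only [Algebra.algebraMap_self, RingHom.id_apply] at h0
    rw [add_sub_cancel_right, h0, sub_eq_zero] at h
    simpa using h
  · intro a ha
    have h := aeval_vanishingPoly_sub (L := K) W a b
    have ha' : Q.eval a = Q.eval b := by simpa using ha
    rw [coe_aeval_eq_eval, coe_aeval_eq_eval, ← hQ, ha', sub_self] at h
    simpa using (aeval_vanishingPoly_algebraMap_eq_zero_iff (L := K) (W : Set K) (a - b)).1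
      (by simpa using h.symm)
  · simp
  · simp
  · intro w _
    simp only [map_add]
    ring

end Subspace

/-- If `W ⊆ F_q` is an `F_P`-subspace, `Y = Q_W(F_q)`, `τ ∈ F_q`, and `Q_W(v) = τ` for `v` in
the algebraic closure, then `v^q - v = Q_Y(τ)`; in particular `Q_Y(τ) ∈ W`. -/
theorem stmt12 (P e : ℕ) (F K : Type*) [Field F] [Fintype F] [Field K] [Fintype K]
    [Algebra F K] (hP : Fintype.card F = P) (hq : Fintype.card K = P ^ e)
    (W : Submodule F K) (τ : K) (v : AlgebraicClosure K)
    (hv : Polynomial.aeval v (vanishingPoly (W : Set K)) = algebraMap K (AlgebraicClosure K) τ) :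
    v ^ P ^ e - v = algebraMap K (AlgebraicClosure K)
        ((vanishingPoly (Set.range fun y : K => (vanishingPoly (W : Set K)).eval y)).eval τ) ∧
    (vanishingPoly (Set.range fun y : K => (vanishingPoly (W : Set K)).eval y)).eval τ ∈ W := by
  have hcard : Nat.card K = P ^ e := by rw [Nat.card_eq_fintype_card, hq]
  have hfrob : v ^ P ^ e - v = algebraMap K (AlgebraicClosure K)
      ((vanishingPoly (Set.range fun y : K => (vanishingPoly (W : Set K)).eval y)).eval τ) := by
    rw [← hcard, ← aeval_vanishingPoly_range W v, hv, aeval_algebraMap_apply, coe_aeval_eq_eval]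
  refine ⟨hfrob, ?_⟩
  have hpow : aeval (v ^ P ^ e) (vanishingPoly (W : Set K)) =
      algebraMap K (AlgebraicClosure K) τ := by
    have h := congrArg (FiniteField.frobeniusAlgHom K (AlgebraicClosure K)) hv
    rw [← aeval_algHom_apply, AlgHom.commutes, FiniteField.frobeniusAlgHom_apply, hq] at h
    exact h
  have hzero := aeval_vanishingPoly_sub W (v ^ P ^ e) v
  rw [hpow, hv, sub_self, hfrob] at hzero
  exact (aeval_vanishingPoly_algebraMap_eq_zero_iff (W : Set K) _).1 hzero.symm
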